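/- Let r ∈ ℝ and let f be a differentiable r-concave function on a nonempty open convex set C ⊆ ℝⁿ. Then f is pseudoconcave on C. -/

import Mathlib

open RealInnerProductSpace

/-- `f` is pseudoconcave on `C` (differentiable case). -/
def PseudoconcaveOn {n : ℕ} (C : Set (EuclideanSpace ℝ (Fin n)))
    (f : EuclideanSpace ℝ (Fin n) → ℝ) : Prop :=
  ∀ x₁ ∈ C, ∀ x₂ ∈ C, ⟪gradient f x₁, x₂ - x₁⟫ ≤ 0 → f x₂ ≤ f x₁

/-- `f` is `r`-concave on `C`: for `r > 0` the function `x ↦ exp (r * f x)` is concave,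
for `r < 0` it is convex, and for `r = 0` the function `f` itself is concave. -/
def RConcaveOn {n : ℕ} (r : ℝ) (C : Set (EuclideanSpace ℝ (Fin n)))
    (f : EuclideanSpace ℝ (Fin n) → ℝ) : Prop :=
  if r = 0 then ConcaveOn ℝ C f
  else if 0 < r then ConcaveOn ℝ C (fun x => Real.exp (r * f x))
  else ConvexOn ℝ C (fun x => Real.exp (r * f x))

/-- A concave function lies below its tangent at a point of differentiability. -/
theorem ConcaveOn.le_add_of_hasFDerivAt {E : Type*} [NormedAddCommGroup E] [NormedSpace ℝ E]
    {s : Set E} {g : E → ℝ} {g' : E →L[ℝ] ℝ} {x y : E} (hg : ConcaveOn ℝ s g)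
    (hx : x ∈ s) (hy : y ∈ s) (hg' : HasFDerivAt g g' x) :
    g y ≤ g x + g' (y - x) := by
  have hline := hg.comp_affineMap (AffineMap.lineMap (k := ℝ) x y)
  have hderiv : HasDerivAt (g ∘ AffineMap.lineMap (k := ℝ) x y) (g' (y - x)) 0 := by
    apply HasFDerivAt.comp_hasDerivAt (0 : ℝ) _ AffineMap.hasDerivAt_lineMap
    simpa using hg'
  have hslope := hline.slope_le_of_hasDerivAt (x := 0) (y := 1) (by simpa using hx)
    (by simpa using hy) one_pos hderiv
  simp [slope_def_field] at hslope
  rw [map_sub]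
  linarith

/-- A convex function lies above its tangent at a point of differentiability. -/
theorem ConvexOn.add_le_of_hasFDerivAt {E : Type*} [NormedAddCommGroup E] [NormedSpace ℝ E]
    {s : Set E} {g : E → ℝ} {g' : E →L[ℝ] ℝ} {x y : E} (hg : ConvexOn ℝ s g)
    (hx : x ∈ s) (hy : y ∈ s) (hg' : HasFDerivAt g g' x) :
    g x + g' (y - x) ≤ g y := by
  have h := hg.neg.le_add_of_hasFDerivAt hx hy hg'.neg
  simp at h
  rw [map_sub]
  linarith

theorem stmt_5 {n : ℕ} (r : ℝ) (C : Set (EuclideanSpace ℝ (Fin n)))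
    (f : EuclideanSpace ℝ (Fin n) → ℝ)
    (hne : C.Nonempty) (hopen : IsOpen C) (hconv : Convex ℝ C)
    (hdiff : ∀ x ∈ C, DifferentiableAt ℝ f x)
    (hrc : RConcaveOn r C f) :
    PseudoconcaveOn C f := by
  intro x hx y hy hgrad
  have hf : HasFDerivAt f (fderiv ℝ f x) x := (hdiff x hx).hasFDerivAt
  have hle : fderiv ℝ f x (y - x) ≤ 0 := by
    simpa [gradient] using hgrad
  have hexp := (hf.const_mul r).exp
  unfold RConcaveOn at hrc
  split_ifs at hrc with hzero hpos
  · linarith [hrc.le_add_of_hasFDerivAt hx hy hf]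
  · have htangent := hrc.le_add_of_hasFDerivAt hx hy hexp
    have hnonpos : Real.exp (r * f x) * (r * fderiv ℝ f x (y - x)) ≤ 0 :=
      mul_nonpos_of_nonneg_of_nonpos (Real.exp_pos _).le
        (mul_nonpos_of_nonneg_of_nonpos hpos.le hle)
    simp only [smul_apply, smul_eq_mul] at htangent
    exact le_of_mul_le_mul_left (Real.exp_le_exp.mp (by linarith)) hpos
  · have hneg : r < 0 := lt_of_le_of_ne (not_lt.mp hpos) hzero
    have htangent := hrc.add_le_of_hasFDerivAt hx hy hexp
    have hnonneg : 0 ≤ Real.exp (r * f x) * (r * fderiv ℝ f x (y - x)) :=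
      mul_nonneg (Real.exp_pos _).le (mul_nonneg_of_nonpos_of_nonpos hneg.le hle)
    simp only [smul_apply, smul_eq_mul] at htangent
    exact (mul_le_mul_left_of_neg hneg).mp (Real.exp_le_exp.mp (by linarith))
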